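/- arXiv:1303.3598 — 2 statements merged into one kernel-verified Lean document; each statement's English description precedes it below -/
import Mathlib

section
/- Let C be a flag normal simplicial d-complex. Then any two facets of C are connected by a non-revisiting facet path; in particular, if C has n vertices, the diameter of the dual graph of C is at most n - (d+1). -/
variable {V : Type*}

/-- An abstract simplicial complex: a collection of finite vertex sets closed under subsets. -/
def IsComplex [DecidableEq V] (C : Set (Finset V)) : Prop :=
  ∀ s ∈ C, ∀ t ⊆ s, t ∈ C

/-- A facet is an inclusion-maximal face. -/
def IsFacet [DecidableEq V] (C : Set (Finset V)) (F : Finset V) : Prop :=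
  F ∈ C ∧ ∀ G ∈ C, F ⊆ G → G = F

/-- A pure `d`-complex: every facet has `d+1` vertices. -/
def PureCplx [DecidableEq V] (C : Set (Finset V)) (d : ℕ) : Prop :=
  ∀ F, IsFacet C F → F.card = d + 1

/-- A facet path of length `L`: consecutive facets share a `(d-1)`-face. -/
def IsFacetPath [DecidableEq V] (C : Set (Finset V)) (d : ℕ) (Γ : ℕ → Finset V) (L : ℕ) : Prop :=
  (∀ i ≤ L, IsFacet C (Γ i)) ∧ ∀ i < L, (Γ i ∩ Γ (i + 1)).card = d

/-- A facet path is non-revisiting if whenever a vertex lies in two facets of the path,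
it lies in all intermediate facets. -/
def NonRevisiting (Γ : ℕ → Finset V) (L : ℕ) : Prop :=
  ∀ v : V, ∀ i j k : ℕ, i ≤ k → k ≤ j → j ≤ L → v ∈ Γ i → v ∈ Γ j → v ∈ Γ k

/-- The set of vertices of a complex. -/
def VertexSet [DecidableEq V] (C : Set (Finset V)) : Set V := {v | {v} ∈ C}

/-- The star of a face `σ`. -/
def St [DecidableEq V] (σ : Finset V) (C : Set (Finset V)) : Set (Finset V) :=
  {τ | τ ∪ σ ∈ C}

/-- The link of a face `σ`. -/
def Lk [DecidableEq V] (σ : Finset V) (C : Set (Finset V)) : Set (Finset V) :=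
  {τ | τ ∩ σ = ∅ ∧ τ ∪ σ ∈ C}

/-- A flag complex: every inclusion-minimal non-face (with all vertices in the complex)
has exactly two elements. -/
def FlagCplx [DecidableEq V] (C : Set (Finset V)) : Prop :=
  ∀ s : Finset V, (∀ v ∈ s, ({v} : Finset V) ∈ C) → s ∉ C → (∀ t ⊂ s, t ∈ C) → s.card = 2

/-- A normal complex: pure, and for each face `σ` the dual graph of the star of `σ`
is connected (any two facets containing `σ` are joined by a facet path staying in the star). -/
def NormalCplx [DecidableEq V] (C : Set (Finset V)) (d : ℕ) : Prop :=
  PureCplx C d ∧ ∀ σ ∈ C, ∀ X Y : Finset V, IsFacet C X → IsFacet C Y → σ ⊆ X → σ ⊆ Y →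
    ∃ Γ L, IsFacetPath C d Γ L ∧ Γ 0 = X ∧ Γ L = Y ∧ ∀ i ≤ L, σ ⊆ Γ i

/-- A vertex path in the 1-skeleton. -/
def IsVertexPath [DecidableEq V] (C : Set (Finset V)) (x : ℕ → V) (ℓ : ℕ) : Prop :=
  ∀ i < ℓ, ({x i, x (i + 1)} : Finset V) ∈ C

/-- Connectivity of the dual (facet-ridge) graph. -/
def DualConnected [DecidableEq V] (C : Set (Finset V)) (d : ℕ) : Prop :=
  ∀ X Y, IsFacet C X → IsFacet C Y →
    ∃ Γ L, IsFacetPath C d Γ L ∧ Γ 0 = X ∧ Γ L = Y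

namespace FlagNormal

open Finset

/-- A finite flag normal `d`-complex, where flagness is expressed by saying that every set of
pairwise adjacent vertices is a face. -/
structure IsFlagNormal [DecidableEq V] (C : Set (Finset V)) (d : ℕ) : Prop where
  complex : IsComplex C
  clique_mem : ∀ s : Finset V, (∀ u ∈ s, ∀ v ∈ s, ({u, v} : Finset V) ∈ C) → s ∈ C
  normal : NormalCplx C d
  finite : (VertexSet C).Finite

section Complex

variable [DecidableEq V] {C : Set (Finset V)} {d : ℕ}

lemma FlagCplx.clique_mem (hflag : FlagCplx C) (s : Finset V)
    (hs : ∀ u ∈ s, ∀ v ∈ s, ({u, v} : Finset V) ∈ C) : s ∈ C := by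
  induction s using Finset.strongInduction with
  | H s ih =>
    by_contra hsC
    have hcard := hflag s (fun v hv => by simpa using hs v hv v hv) hsC
      fun t ht => ih t ht fun u hu v hv => hs u (ht.1 hu) v (ht.1 hv)
    obtain ⟨u, v, -, rfl⟩ := Finset.card_eq_two.1 hcard
    exact hsC (hs u (by simp) v (by simp))

lemma pair_mem (hC : IsComplex C) {F : Finset V} (hF : F ∈ C) {u v : V} (hu : u ∈ F)
    (hv : v ∈ F) : ({u, v} : Finset V) ∈ C :=
  hC F hF _ (by simp [insert_subset_iff, hu, hv])

lemma singleton_mem (hC : IsComplex C) {F : Finset V} (hF : F ∈ C) {v : V} (hv : v ∈ F) :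
    ({v} : Finset V) ∈ C :=
  hC F hF _ (by simpa using hv)

lemma exists_facet_superset (hC : IsComplex C) (hfin : (VertexSet C).Finite) {s : Finset V}
    (hs : s ∈ C) : ∃ F, IsFacet C F ∧ s ⊆ F := by
  have hCfin : C.Finite := by
    refine (hfin.toFinset.powerset.finite_toSet).subset fun t ht => ?_
    simp only [coe_powerset, Set.mem_preimage, Set.mem_powerset_iff]
    intro v hv
    exact hfin.mem_toFinset.2 (singleton_mem hC ht hv)
  obtain ⟨F, hsF, hF⟩ := hCfin.exists_le_maximal hs
  exact ⟨F, ⟨hF.prop, fun G hG hFG => (hF.eq_of_le hG hFG).symm⟩, hsF⟩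

lemma mem_link {x : V} {t : Finset V} : t ∈ Lk {x} C ↔ x ∉ t ∧ insert x t ∈ C := by
  have : t ∪ {x} = insert x t := by ext; simp
  simp only [Lk, Set.mem_ofPred_eq, this]
  rw [← disjoint_iff_inter_eq_empty, disjoint_singleton_right]

lemma isFacet_link {x : V} {F : Finset V} :
    IsFacet (Lk {x} C) F ↔ x ∉ F ∧ IsFacet C (insert x F) := by
  constructor
  · rintro ⟨hF, hmax⟩
    obtain ⟨hxF, hFC⟩ := mem_link.1 hF
    refine ⟨hxF, hFC, fun G hG hFG => ?_⟩
    have hxG : x ∈ G := hFG (mem_insert_self _ _)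
    have := hmax (G.erase x) (mem_link.2 ⟨by simp, by rwa [insert_erase hxG]⟩)
      fun v hv => mem_erase.2 ⟨fun h => hxF (h ▸ hv), hFG (mem_insert_of_mem hv)⟩
    rw [← this, insert_erase hxG]
  · rintro ⟨hxF, hFC, hmax⟩
    refine ⟨mem_link.2 ⟨hxF, hFC⟩, fun G hG hFG => ?_⟩
    obtain ⟨hxG, hGC⟩ := mem_link.1 hG
    have := hmax _ hGC (insert_subset_insert x hFG)
    rw [← erase_insert hxG, this, erase_insert hxF]

lemma IsFacet.erase {x : V} {F : Finset V} (hF : IsFacet C F) (hx : x ∈ F) :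
    IsFacet (Lk {x} C) (F.erase x) :=
  isFacet_link.2 ⟨by simp, by rwa [insert_erase hx]⟩

/-- Links of vertices in flag normal complexes are flag normal. -/
lemma IsFlagNormal.link (h : IsFlagNormal C (d + 1)) {x : V} (hx : ({x} : Finset V) ∈ C) :
    IsFlagNormal (Lk {x} C) d where
  complex s hs t hts := by
    obtain ⟨hxs, hsC⟩ := mem_link.1 hs
    exact mem_link.2 ⟨fun hxt => hxs (hts hxt), h.complex _ hsC _ (insert_subset_insert x hts)⟩
  clique_mem s hs := by
    have hadj : ∀ u ∈ s, ∀ v ∈ s, x ∉ ({u, v} : Finset V) ∧ insert x {u, v} ∈ C :=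
      fun u hu v hv => mem_link.1 (hs u hu v hv)
    refine mem_link.2 ⟨fun hxs => (hadj x hxs x hxs).1 (by simp), h.clique_mem _ ?_⟩
    intro u hu v hv
    rcases mem_insert.1 hu with hux | hu <;> rcases mem_insert.1 hv with hvx | hv
    · subst hux hvx
      simpa using hx
    · exact pair_mem h.complex (hadj v hv v hv).2 (by simp [hux]) (by simp)
    · exact pair_mem h.complex (hadj u hu u hu).2 (by simp) (by simp [hvx])
    · exact pair_mem h.complex (hadj u hu v hv).2 (by simp) (by simp)
  normal := by
    refine ⟨fun F hF => ?_, fun σ hσ X Y hX hY hσX hσY => ?_⟩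
    · obtain ⟨hxF, hFC⟩ := isFacet_link.1 hF
      have := h.normal.1 _ hFC
      rw [card_insert_of_notMem hxF] at this
      omega
    · obtain ⟨hxX, hXC⟩ := isFacet_link.1 hX
      obtain ⟨hxY, hYC⟩ := isFacet_link.1 hY
      obtain ⟨Γ, L, hΓ, h0, hL, hsub⟩ := h.normal.2 _ (mem_link.1 hσ).2 _ _ hXC hYC
        (insert_subset_insert x hσX) (insert_subset_insert x hσY)
      have hxΓ : ∀ i ≤ L, x ∈ Γ i := fun i hi => hsub i hi (mem_insert_self _ _)
      refine ⟨fun i => (Γ i).erase x, L, ⟨fun i hi => IsFacet.erase (hΓ.1 i hi) (hxΓ i hi),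
        fun i hi => ?_⟩, by simp [h0, hxX], by simp [hL, hxY], fun i hi v hv => ?_⟩
      · have hx' : x ∈ Γ i ∩ Γ (i + 1) :=
          mem_inter.2 ⟨hxΓ i hi.le, hxΓ (i + 1) hi⟩
        have : (Γ i).erase x ∩ (Γ (i + 1)).erase x = (Γ i ∩ Γ (i + 1)).erase x := by
          ext; simp; tauto
        simp only [this, card_erase_of_mem hx', hΓ.2 i hi, Nat.add_sub_cancel]
      · exact mem_erase.2 ⟨fun hvx => (mem_link.1 hσ).1 (hvx ▸ hv),
          hsub i hi (mem_insert_of_mem hv)⟩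
  finite := h.finite.subset fun v hv =>
    singleton_mem h.complex (mem_link.1 hv).2 (by simp)

end Complex

section Paths

/-- Concatenation of a path of length `L` with a second path. -/
def concat (Γ : ℕ → Finset V) (L : ℕ) (Γ' : ℕ → Finset V) (i : ℕ) : Finset V :=
  if i ≤ L then Γ i else Γ' (i - L)

lemma concat_of_le {Γ Γ' : ℕ → Finset V} {L i : ℕ} (hi : i ≤ L) : concat Γ L Γ' i = Γ i :=
  if_pos hi

lemma concat_add {Γ Γ' : ℕ → Finset V} {L : ℕ} (hend : Γ L = Γ' 0) (j : ℕ) :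
    concat Γ L Γ' (L + j) = Γ' j := by
  rcases j with _ | j
  · simp [concat, hend]
  · simp [concat]

lemma NonRevisiting.concat {Γ Γ' : ℕ → Finset V} {L L' : ℕ} (hΓ : NonRevisiting Γ L)
    (hΓ' : NonRevisiting Γ' L') (hend : Γ L = Γ' 0)
    (hcross : ∀ v, ∀ i ≤ L, ∀ j ≤ L', v ∈ Γ i → v ∈ Γ' j → v ∈ Γ L) :
    NonRevisiting (concat Γ L Γ') (L + L') := by
  intro v i j k hik hkj hj hvi hvj
  rcases le_total j L with hjL | hjL
  · rw [concat_of_le (by omega)] at hvi hvj ⊢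
    exact hΓ v i j k hik hkj hjL hvi hvj
  · obtain ⟨j, rfl⟩ := Nat.exists_eq_add_of_le hjL
    rw [concat_add hend] at hvj
    rcases le_total i L with hiL | hiL
    · rw [concat_of_le hiL] at hvi
      have hvL := hcross v i hiL j (by omega) hvi hvj
      rcases le_total k L with hkL | hkL
      · rw [concat_of_le hkL]
        exact hΓ v i L k hik hkL le_rfl hvi hvL
      · obtain ⟨k, rfl⟩ := Nat.exists_eq_add_of_le hkL
        rw [concat_add hend]
        exact hΓ' v 0 j k (by omega) (by omega) (by omega) (hend ▸ hvL) hvj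
    · obtain ⟨i, rfl⟩ := Nat.exists_eq_add_of_le hiL
      obtain ⟨k, rfl⟩ := Nat.exists_eq_add_of_le (hiL.trans hik)
      rw [concat_add hend] at hvi ⊢
      exact hΓ' v i j k (by omega) (by omega) (by omega) hvi hvj

lemma nonRevisiting_of_le_one {Γ : ℕ → Finset V} {L : ℕ} (hL : L ≤ 1) :
    NonRevisiting Γ L := by
  intro v i j k hik hkj hj hvi hvj
  obtain rfl | rfl : k = i ∨ k = j := by omega
  exacts [hvi, hvj]

variable [DecidableEq V] {C : Set (Finset V)} {d : ℕ}

lemma IsFacetPath.concat {Γ Γ' : ℕ → Finset V} {L L' : ℕ} (hΓ : IsFacetPath C d Γ L)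
    (hΓ' : IsFacetPath C d Γ' L') (hend : Γ L = Γ' 0) :
    IsFacetPath C d (concat Γ L Γ') (L + L') := by
  constructor
  · intro i hi
    rcases le_total i L with hiL | hiL
    · rw [concat_of_le hiL]
      exact hΓ.1 i hiL
    · obtain ⟨j, rfl⟩ := Nat.exists_eq_add_of_le hiL
      rw [concat_add hend]
      exact hΓ'.1 j (by omega)
  · intro i hi
    rcases lt_or_ge i L with hiL | hiL
    · rw [concat_of_le hiL.le, concat_of_le hiL]
      exact hΓ.2 i hiL
    · obtain ⟨j, rfl⟩ := Nat.exists_eq_add_of_le hiL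
      rw [concat_add hend, add_assoc, concat_add hend]
      exact hΓ'.2 j (by omega)

lemma IsFacetPath.insert {x : V} {Γ : ℕ → Finset V} {L : ℕ}
    (hΓ : IsFacetPath (Lk {x} C) d Γ L) :
    IsFacetPath C (d + 1) (fun i => insert x (Γ i)) L := by
  refine ⟨fun i hi => (isFacet_link.1 (hΓ.1 i hi)).2, fun i hi => ?_⟩
  have hx : x ∉ Γ i ∩ Γ (i + 1) := fun h =>
    (isFacet_link.1 (hΓ.1 i hi.le)).1 (mem_inter.1 h).1
  simp only [← insert_inter_distrib, card_insert_of_notMem hx, hΓ.2 i hi]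

lemma NonRevisiting.insert {Γ : ℕ → Finset V} {L : ℕ} (x : V) (hΓ : NonRevisiting Γ L) :
    NonRevisiting (fun i => insert x (Γ i)) L := by
  intro v i j k hik hkj hj hvi hvj
  rcases eq_or_ne v x with rfl | hvx
  · exact mem_insert_self _ _
  · exact mem_insert_of_mem (hΓ v i j k hik hkj hj (mem_of_mem_insert_of_ne hvi hvx)
      (mem_of_mem_insert_of_ne hvj hvx))

lemma isFacetPath_const {X : Finset V} (hX : IsFacet C X) : IsFacetPath C d (fun _ => X) 0 :=
  ⟨fun _ _ => hX, fun _ hi => absurd hi (Nat.not_lt_zero _)⟩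

/-- Every step of a non-revisiting path reaches a new vertex. -/
lemma add_length_le_card (hpure : PureCplx C d) {Γ : ℕ → Finset V} {L : ℕ}
    (hΓ : IsFacetPath C d Γ L) (hnr : NonRevisiting Γ L) {T : Finset V}
    (hT : ∀ i ≤ L, Γ i ⊆ T) : d + 1 + L ≤ T.card := by
  suffices h : ∀ k ≤ L, d + 1 + k ≤ ((range (k + 1)).biUnion Γ).card by
    refine (h L le_rfl).trans (card_le_card (biUnion_subset.2 fun i hi => hT i ?_))
    simpa [Nat.lt_succ_iff] using hi
  intro k
  induction k with
  | zero => simp [hpure _ (hΓ.1 0 (Nat.zero_le _))]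
  | succ k ih =>
    intro hk
    obtain ⟨v, hv, hvk⟩ : ∃ v ∈ Γ (k + 1), v ∉ Γ k := by
      by_contra! hsub
      have hcard := hΓ.2 k hk
      rw [inter_eq_right.2 hsub, hpure _ (hΓ.1 _ hk)] at hcard
      omega
    have hnew : v ∉ (range (k + 1)).biUnion Γ := by
      simp only [mem_biUnion, mem_range, not_exists, not_and]
      exact fun i hi hvi => hvk (hnr v i (k + 1) k (by omega) (by omega) hk hvi hv)
    have hsub : insert v ((range (k + 1)).biUnion Γ) ⊆ (range (k + 1 + 1)).biUnion Γ := by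
      refine insert_subset (mem_biUnion.2 ⟨k + 1, by simp, hv⟩) ?_
      exact biUnion_subset_biUnion_of_subset_left _ (range_subset_range.2 (by omega))
    have := card_le_card hsub
    rw [card_insert_of_notMem hnew] at this
    have := ih (by omega)
    omega

end Paths

section Segments

variable [DecidableEq V] {C : Set (Finset V)} {d : ℕ}

/-- The vertices joined to `S` by an edge path of length `n`. -/
def ball (C : Set (Finset V)) (S : Set V) : ℕ → Set V
  | 0 => S
  | n + 1 => {v | ∃ u ∈ ball C S n, ({v, u} : Finset V) ∈ C}

lemma ball_subset_vertexSet (hC : IsComplex C) {S : Set V} (hS : S ⊆ VertexSet C) (n : ℕ) :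
    ball C S n ⊆ VertexSet C := by
  rcases n with _ | n
  · exact hS
  · rintro v ⟨u, -, huv⟩
    exact singleton_mem hC huv (by simp)

lemma ball_mono (hC : IsComplex C) {S : Set V} (hS : S ⊆ VertexSet C) : Monotone (ball C S) :=
  monotone_nat_of_le_succ fun n v hv =>
    ⟨v, hv, by simpa [VertexSet] using ball_subset_vertexSet hC hS n hv⟩

lemma exists_mem_ball (h : IsFlagNormal C (d + 1)) {S : Set V} (hS : S ⊆ VertexSet C)
    (hne : S.Nonempty) {X : Finset V} (hX : IsFacet C X) {x : V} (hx : x ∈ X) :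
    ∃ n, x ∈ ball C S n := by
  obtain ⟨s, hs⟩ := hne
  obtain ⟨Y, hY, hsY⟩ := exists_facet_superset h.complex h.finite (hS hs)
  obtain ⟨Γ, L, hΓ, h0, hL, -⟩ := h.normal.2 ∅ (h.complex X hX.1 ∅ (empty_subset X)) X Y hX hY
    (empty_subset X) (empty_subset Y)
  suffices ∀ k ≤ L, ∀ v ∈ Γ (L - k), ∃ n, v ∈ ball C S n from
    this L le_rfl x (by simpa [h0] using hx)
  intro k
  induction k with
  | zero =>
    intro _ v hv
    refine ⟨1, s, hs, pair_mem h.complex hY.1 (by simpa [hL] using hv) (hsY (by simp))⟩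
  | succ k ih =>
    intro hk v hv
    have hcard := hΓ.2 (L - (k + 1)) (by omega)
    rw [show L - (k + 1) + 1 = L - k by omega] at hcard
    obtain ⟨u, hu⟩ : (Γ (L - (k + 1)) ∩ Γ (L - k)).Nonempty := card_pos.1 (by omega)
    obtain ⟨n, hn⟩ := ih (by omega) u (mem_inter.1 hu).2
    exact ⟨n + 1, u, hn,
      pair_mem h.complex (hΓ.1 (L - (k + 1)) (by omega)).1 hv (mem_inter.1 hu).1⟩

/-- A non-revisiting facet path from `X` to a vertex set `S`, stopping as soon as it meets `S`,
whose last facet contains every vertex of the path adjacent to a point of `S` reached. -/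
structure IsSegment (C : Set (Finset V)) (d : ℕ) (X : Finset V) (S : Set V)
    (Γ : ℕ → Finset V) (L : ℕ) : Prop where
  path : IsFacetPath C d Γ L
  start : Γ 0 = X
  meets : ∃ s ∈ Γ L, s ∈ S
  first : ∀ i < L, ∀ v ∈ Γ i, v ∉ S
  nonRevisiting : NonRevisiting Γ L
  adjacent_mem : ∀ s ∈ Γ L, s ∈ S → ∀ i ≤ L, ∀ v ∈ Γ i, ({v, s} : Finset V) ∈ C → v ∈ Γ L

lemma isSegment_const {X : Finset V} {S : Set V} (hX : IsFacet C X) (hXS : ∃ s ∈ X, s ∈ S) :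
    IsSegment C d X S (fun _ => X) 0 where
  path := isFacetPath_const hX
  start := rfl
  meets := hXS
  first _ hi := absurd hi (Nat.not_lt_zero _)
  nonRevisiting := nonRevisiting_of_le_one zero_le_one
  adjacent_mem _ _ _ _ _ _ hv _ := hv

lemma exists_segment_zero (h : IsFlagNormal C 0) {S : Set V} (hS : S ⊆ VertexSet C)
    (hne : S.Nonempty) {X : Finset V} (hX : IsFacet C X) : ∃ Γ L, IsSegment C 0 X S Γ L := by
  by_cases hXS : ∃ s ∈ X, s ∈ S
  · exact ⟨_, _, isSegment_const hX hXS⟩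
  push Not at hXS
  obtain ⟨s, hs⟩ := hne
  obtain ⟨F, hF, hsF⟩ := exists_facet_superset h.complex h.finite (hS hs)
  have hFs : F = {s} :=
    (eq_of_subset_of_card_le hsF (by simp [h.normal.1 F hF])).symm
  subst hFs
  refine ⟨fun i => if i = 0 then X else {s}, 1, ⟨?_, ?_⟩, by simp, ⟨s, by simp, hs⟩, ?_,
    nonRevisiting_of_le_one le_rfl, ?_⟩
  · intro i _
    by_cases hi : i = 0 <;> simp [hi, hX, hF]
  · intro i hi
    obtain rfl : i = 0 := by omega
    have : s ∉ X := fun hsX => hXS s hsX hs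
    simp [this]
  · intro i hi v hv
    obtain rfl : i = 0 := by omega
    exact hXS v (by simpa using hv)
  · intro t ht _ i _ v _ hvt
    obtain rfl : t = s := by simpa using ht
    have := hF.2 _ hvt (by simp)
    have : v ∈ ({t} : Finset V) := this ▸ mem_insert_self _ _
    simpa using this

/-- Segments from `X` to `S` obtained by following a shortest edge path from `x ∈ X` to `S`,
moving in the link of each of its vertices. -/
lemma exists_segment_of_mem_ball (h : IsFlagNormal C (d + 1)) {S : Set V}
    (hS : S ⊆ VertexSet C)
    (hlink : ∀ x, ({x} : Finset V) ∈ C → ∀ T ⊆ VertexSet (Lk {x} C), T.Nonempty →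
      ∀ X, IsFacet (Lk {x} C) X → ∃ Γ L, IsSegment (Lk {x} C) d X T Γ L)
    (δ : ℕ) {X : Finset V} (hX : IsFacet C X) {x : V} (hxX : x ∈ X) (hx : x ∈ ball C S δ)
    (hmin : ∀ m < δ, x ∉ ball C S m) :
    ∃ Γ L, IsSegment C (d + 1) X S Γ L ∧
      ∀ i ≤ L, ∀ v ∈ Γ i, ({v, x} : Finset V) ∈ C ∨ v ∈ ball C S δ := by
  induction δ generalizing X x with
  | zero =>
    exact ⟨_, _, isSegment_const hX ⟨x, hxX, hx⟩,
      fun _ _ v hv => Or.inl (pair_mem h.complex hX.1 hv hxX)⟩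
  | succ δ ih =>
    have hxC := singleton_mem h.complex hX.1 hxX
    obtain ⟨u, hu, hxu⟩ := hx
    have hux : x ≠ u := fun e => hmin δ (by omega) (e ▸ hu)
    obtain ⟨Γ, L, hΓ⟩ := hlink x hxC {v | v ∈ ball C S δ ∧ v ∈ VertexSet (Lk {x} C)}
      (fun v hv => hv.2) ⟨u, hu, mem_link.2 ⟨by simpa using hux, hxu⟩⟩ _
      (IsFacet.erase hX hxX)
    obtain ⟨y, hyΓ, hyball, -⟩ := hΓ.meets
    have hfacet : ∀ i ≤ L, IsFacet C (insert x (Γ i)) := fun i hi =>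
      (isFacet_link.1 (hΓ.path.1 i hi)).2
    have hvert : ∀ i ≤ L, ∀ v ∈ Γ i, v ∈ VertexSet (Lk {x} C) := fun i hi v hv =>
      singleton_mem (h.link hxC).complex (hΓ.path.1 i hi).1 hv
    have mem_last_of_mem_ball : ∀ i ≤ L, ∀ v ∈ Γ i, v ∈ ball C S δ → v ∈ Γ L := by
      intro i hi v hv hvball
      rcases hi.lt_or_eq with hi | rfl
      · exact absurd ⟨hvball, hvert i hi.le v hv⟩ (hΓ.first i hi v hv)
      · exact hv
    have hadj : ∀ z ∈ Γ L, z ∈ ball C S δ → ∀ i ≤ L, ∀ v ∈ Γ i,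
        ({v, z} : Finset V) ∈ C → v ∈ Γ L := by
      intro z hz hzball i hi v hv hvz
      have hv' := mem_link.1 (hvert i hi v hv)
      have hz' := mem_link.1 (hvert L le_rfl z hz)
      have hlinkvz : ({v, z} : Finset V) ∈ Lk {x} C := by
        refine mem_link.2 ⟨by simp_all, h.clique_mem _ ?_⟩
        have hxv : ({x, v} : Finset V) ∈ C := hv'.2
        have hxz : ({x, z} : Finset V) ∈ C := hz'.2
        have hvC := singleton_mem h.complex hvz (v := v) (by simp)
        have hzC := singleton_mem h.complex hvz (v := z) (by simp)
        intro a ha b hb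
        simp only [mem_insert, mem_singleton] at ha hb
        rcases ha with rfl | rfl | rfl <;> rcases hb with rfl | rfl | rfl <;>
          first
          | assumption
          | (rw [pair_comm]; assumption)
          | (rw [pair_eq_singleton]; assumption)
      exact hΓ.adjacent_mem z hz ⟨hzball, hvert L le_rfl z hz⟩ i hi v hv hlinkvz
    obtain ⟨Γ', L', hΓ', hnear⟩ := ih (hfacet L le_rfl) (mem_insert_of_mem hyΓ) hyball
      fun m hm hym => hmin (m + 1) (by omega) ⟨y, hym,
        pair_mem h.complex (hfacet L le_rfl).1 (by simp) (mem_insert_of_mem hyΓ)⟩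
    have hend : (fun i => insert x (Γ i)) L = Γ' 0 := hΓ'.start.symm
    have hxS : x ∉ S := hmin 0 (by omega)
    refine ⟨concat (fun i => insert x (Γ i)) L Γ', L + L', ⟨?_, ?_, ?_, ?_, ?_, ?_⟩, ?_⟩
    · exact IsFacetPath.concat (IsFacetPath.insert hΓ.path) hΓ'.path hend
    · rw [concat_of_le (Nat.zero_le _), hΓ.start, insert_erase hxX]
    · rw [concat_add hend]
      exact hΓ'.meets
    · intro i hi v hv
      rcases lt_or_ge i L with hiL | hiL
      · rw [concat_of_le hiL.le] at hv
        rcases mem_insert.1 hv with rfl | hv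
        · exact hxS
        · exact fun hvS => hΓ.first i hiL v hv
            ⟨ball_mono h.complex hS (Nat.zero_le δ) hvS, hvert i hiL.le v hv⟩
      · obtain ⟨j, rfl⟩ := Nat.exists_eq_add_of_le hiL
        rw [concat_add hend] at hv
        exact hΓ'.first j (by omega) v hv
    · refine NonRevisiting.concat (NonRevisiting.insert x hΓ.nonRevisiting) hΓ'.nonRevisiting
        hend ?_
      intro v i hi j hj hvi hvj
      rcases mem_insert.1 hvi with rfl | hvi
      · exact mem_insert_self _ _
      · refine mem_insert_of_mem ?_
        rcases hnear j hj v hvj with hvy | hvball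
        · exact hadj y hyΓ hyball i hi v hvi hvy
        · exact mem_last_of_mem_ball i hi v hvi hvball
    · rw [concat_add hend]
      intro s hs hsS i hi v hv hvs
      rcases le_total i L with hiL | hiL
      · rw [concat_of_le hiL] at hv
        refine hΓ'.adjacent_mem s hs hsS 0 (Nat.zero_le _) v ?_ hvs
        rw [hΓ'.start]
        rcases mem_insert.1 hv with rfl | hv
        · exact mem_insert_self _ _
        refine mem_insert_of_mem ?_
        rcases Nat.eq_zero_or_pos δ with rfl | hδ
        · obtain rfl : L' = 0 := by
            by_contra hL'
            exact hΓ'.first 0 (by omega) y (by simp [hΓ'.start, hyΓ]) hyball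
          rw [hΓ'.start] at hs
          refine hadj s (mem_of_mem_insert_of_ne hs ?_) hsS i hiL v hv hvs
          rintro rfl
          exact hxS hsS
        · exact mem_last_of_mem_ball i hiL v hv
            (ball_mono h.complex hS (show 1 ≤ δ from hδ) ⟨s, hsS, hvs⟩)
      · obtain ⟨j, rfl⟩ := Nat.exists_eq_add_of_le hiL
        rw [concat_add hend] at hv
        exact hΓ'.adjacent_mem s hs hsS j (by omega) v hv hvs
    · intro i hi v hv
      rcases le_total i L with hiL | hiL
      · rw [concat_of_le hiL] at hv
        exact Or.inl (pair_mem h.complex (hfacet i hiL).1 hv (mem_insert_self _ _))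
      · obtain ⟨j, rfl⟩ := Nat.exists_eq_add_of_le hiL
        rw [concat_add hend] at hv
        rcases hnear j (by omega) v hv with hvy | hvball
        · exact Or.inr ⟨y, hyball, hvy⟩
        · exact Or.inr (ball_mono h.complex hS (Nat.le_succ δ) hvball)

lemma exists_segment (h : IsFlagNormal C d) {S : Set V} (hS : S ⊆ VertexSet C)
    (hne : S.Nonempty) {X : Finset V} (hX : IsFacet C X) : ∃ Γ L, IsSegment C d X S Γ L := by
  classical
  induction d generalizing C S X with
  | zero => exact exists_segment_zero h hS hne hX
  | succ d ih =>
    obtain ⟨x, hxX⟩ : X.Nonempty := card_pos.1 (by rw [h.normal.1 X hX]; omega)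
    have hex := exists_mem_ball h hS hne hX hxX
    obtain ⟨Γ, L, hΓ, -⟩ := exists_segment_of_mem_ball h hS
      (fun x hx T hT hTne X hX => ih (h.link hx) hT hTne hX) (Nat.find hex) hX hxX
      (Nat.find_spec hex) fun m hm => Nat.find_min hex hm
    exact ⟨Γ, L, hΓ⟩

lemma exists_nonRevisiting_path (h : IsFlagNormal C d) {X Y : Finset V} (hX : IsFacet C X)
    (hY : IsFacet C Y) :
    ∃ Γ L, IsFacetPath C d Γ L ∧ Γ 0 = X ∧ Γ L = Y ∧ NonRevisiting Γ L := by
  induction d generalizing C X Y with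
  | zero =>
    by_cases hXY : X = Y
    · exact ⟨_, 0, isFacetPath_const hX, rfl, hXY, nonRevisiting_of_le_one zero_le_one⟩
    refine ⟨fun i => if i = 0 then X else Y, 1, ⟨?_, ?_⟩, by simp, by simp,
      nonRevisiting_of_le_one le_rfl⟩
    · intro i _
      by_cases hi : i = 0 <;> simp [hi, hX, hY]
    · intro i hi
      obtain rfl : i = 0 := by omega
      obtain ⟨a, rfl⟩ := card_eq_one.1 (h.normal.1 X hX)
      obtain ⟨b, rfl⟩ := card_eq_one.1 (h.normal.1 Y hY)
      have : a ≠ b := fun e => hXY (by rw [e])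
      simp [this]
  | succ d ih =>
    have hYne : Y.Nonempty := card_pos.1 (by rw [h.normal.1 Y hY]; omega)
    obtain ⟨Γ, L, hΓ⟩ := exists_segment h (S := (Y : Set V))
      (fun v hv => singleton_mem h.complex hY.1 hv) hYne hX
    obtain ⟨s, hsΓ, hsY⟩ := hΓ.meets
    have hsC := singleton_mem h.complex hY.1 (mem_coe.1 hsY)
    obtain ⟨Γ', L', hΓ', h0, hL, hnr⟩ := ih (h.link hsC)
      (IsFacet.erase (hΓ.path.1 L le_rfl) hsΓ) (IsFacet.erase hY (mem_coe.1 hsY))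
    have hpath := IsFacetPath.insert hΓ'
    have hend : Γ L = (fun i => insert s (Γ' i)) 0 := by simp [h0, insert_erase hsΓ]
    refine ⟨_, _, IsFacetPath.concat hΓ.path hpath hend, ?_, ?_,
      NonRevisiting.concat hΓ.nonRevisiting (NonRevisiting.insert s hnr) hend ?_⟩
    · rw [concat_of_le (Nat.zero_le _), hΓ.start]
    · rw [concat_add hend, hL, insert_erase (mem_coe.1 hsY)]
    · exact fun v i hi j hj hvi hvj => hΓ.adjacent_mem s hsΓ hsY i hi v hvi
        (pair_mem h.complex (hpath.1 j hj).1 hvj (mem_insert_self _ _))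

end Segments

end FlagNormal

/-- Main theorem. In a flag normal simplicial `d`-complex on `n` vertices,
any two facets are joined by a non-revisiting facet path; in particular the dual graph
has diameter at most `n - (d+1)`. -/
theorem stmt_4 [DecidableEq V] (C : Set (Finset V)) (d n : ℕ)
    (hC : IsComplex C) (hflag : FlagCplx C) (hnormal : NormalCplx C d)
    (hfin : (VertexSet C).Finite) (hn : hfin.toFinset.card = n) :
    ∀ X Y : Finset V, IsFacet C X → IsFacet C Y →
      ∃ Γ L, IsFacetPath C d Γ L ∧ Γ 0 = X ∧ Γ L = Y ∧
        NonRevisiting Γ L ∧ L ≤ n - (d + 1) := by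
  intro X Y hX hY
  have h : FlagNormal.IsFlagNormal C d :=
    ⟨hC, FlagNormal.FlagCplx.clique_mem hflag, hnormal, hfin⟩
  obtain ⟨Γ, L, hΓ, h0, hL, hnr⟩ := FlagNormal.exists_nonRevisiting_path h hX hY
  refine ⟨Γ, L, hΓ, h0, hL, hnr, ?_⟩
  have := FlagNormal.add_length_le_card hnormal.1 hΓ hnr (T := hfin.toFinset)
    fun i hi v hv => hfin.mem_toFinset.2 (FlagNormal.singleton_mem hC (hΓ.1 i hi).1 hv)
  omega
end

section
/- Every connected flag triangulated d-manifold on n vertices has dual graph diameter at most n - (d+1). -/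
variable {V : Type*}

/-- A (combinatorial) triangulated `d`-manifold: a pure complex in which every `(d-1)`-face
lies in exactly two facets and all vertex links are triangulated `(d-1)`-manifolds which
are connected whenever their dimension is at least 1. -/
def TriMfld [DecidableEq V] : ℕ → Set (Finset V) → Prop
  | 0, C => IsComplex C ∧ PureCplx C 0
  | d + 1, C => IsComplex C ∧ PureCplx C (d + 1) ∧
      (∀ R ∈ C, R.card = d + 1 → {F | IsFacet C F ∧ R ⊆ F}.ncard = 2) ∧
      ∀ v : V, ({v} : Finset V) ∈ C →
        TriMfld d (Lk {v} C) ∧ (1 ≤ d → DualConnected (Lk {v} C) d)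

/-- A complex is determined by its graph: every set of pairwise adjacent vertices is a face. -/
def IsCliqueCplx [DecidableEq V] (C : Set (Finset V)) : Prop :=
  ∀ s : Finset V, (∀ v ∈ s, ∀ w ∈ s, ({v, w} : Finset V) ∈ C) → s ∈ C

theorem FlagCplx.isCliqueCplx [DecidableEq V] {C : Set (Finset V)} (h : FlagCplx C) :
    IsCliqueCplx C := by
  intro s
  induction s using Finset.strongInduction with
  | H s ih =>
    intro hs
    by_contra hsC
    have h2 := h s (fun v hv => by simpa using hs v hv v hv) hsC
      (fun t ht => ih t ht fun v hv w hw => hs v (ht.1 hv) w (ht.1 hw))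
    obtain ⟨v, w, -, rfl⟩ := Finset.card_eq_two.1 h2
    exact hsC (hs v (by simp) w (by simp))

theorem IsCliqueCplx.link [DecidableEq V] {C : Set (Finset V)} (hC : IsComplex C)
    (h : IsCliqueCplx C) {x : V} (hx : {x} ∈ C) : IsCliqueCplx (Lk {x} C) := by
  intro s hs
  have hxs : ∀ v ∈ s, v ≠ x := by
    rintro v hv rfl
    simpa using (hs v hv v hv).1
  refine ⟨?_, h _ ?_⟩
  · rw [← Finset.disjoint_iff_inter_eq_empty, Finset.disjoint_singleton_right]
    exact fun hx => hxs x hx rfl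
  · intro v hv w hw
    simp only [Finset.mem_union, Finset.mem_singleton] at hv hw
    rcases hv with hv | rfl <;> rcases hw with hw | rfl
    · exact hC _ (hs v hv w hw).2 _ Finset.subset_union_left
    · refine hC _ (hs v hv v hv).2 _ ?_
      intro u; simp
    · refine hC _ (hs w hw w hw).2 _ ?_
      intro u; simp [or_comm]
    · simpa using hx

theorem TriMfld.isComplex [DecidableEq V] {C : Set (Finset V)} {d : ℕ} (h : TriMfld d C) :
    IsComplex C := by
  cases d <;> exact h.1

theorem TriMfld.pure [DecidableEq V] {C : Set (Finset V)} {d : ℕ} (h : TriMfld d C) :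
    PureCplx C d := by
  cases d with
  | zero => exact h.2
  | succ d => exact h.2.1

theorem PureCplx.dualConnected_zero [DecidableEq V] {C : Set (Finset V)} (h : PureCplx C 0) :
    DualConnected C 0 := by
  intro X Y hX hY
  by_cases hXY : X = Y
  · exact ⟨fun _ => X, 0, ⟨fun _ _ => hX, by simp⟩, rfl, hXY⟩
  · refine ⟨fun i => if i = 0 then X else Y, 1, ⟨fun i _ => ?_, fun i hi => ?_⟩, by simp, by simp⟩
    · dsimp only; split_ifs <;> assumption
    · obtain rfl : i = 0 := by omega
      obtain ⟨x, rfl⟩ := Finset.card_eq_one.1 (h X hX)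
      obtain ⟨y, rfl⟩ := Finset.card_eq_one.1 (h Y hY)
      have : x ≠ y := fun e => hXY (by rw [e])
      simp [this]

theorem TriMfld.dualConnected_link [DecidableEq V] {C : Set (Finset V)} {d : ℕ}
    (h : TriMfld (d + 1) C) {v : V} (hv : {v} ∈ C) : DualConnected (Lk {v} C) d := by
  obtain ⟨hT, hD⟩ := h.2.2.2 v hv
  rcases Nat.eq_zero_or_pos d with rfl | hd
  · exact hT.pure.dualConnected_zero
  · exact hD hd

theorem IsComplex.exists_isFacet [DecidableEq V] {C : Set (Finset V)} (hC : IsComplex C)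
    (hfin : (VertexSet C).Finite) {s : Finset V} (hs : s ∈ C) :
    ∃ F, IsFacet C F ∧ s ⊆ F := by
  have hCfin : C.Finite := by
    refine (Finset.finite_toSet hfin.toFinset.powerset).subset fun t ht => ?_
    simp only [Finset.coe_powerset, Set.mem_preimage, Set.mem_powerset_iff]
    intro v hv
    exact hfin.mem_toFinset.2 (hC t ht {v} (by simpa using hv))
  obtain ⟨F, hsF, hF⟩ := hCfin.exists_le_maximal hs
  exact ⟨F, ⟨hF.1, fun G hG hFG => (hF.2 hG hFG).antisymm hFG⟩, hsF⟩

theorem vertexSet_link_subset [DecidableEq V] {C : Set (Finset V)} (hC : IsComplex C) (x : V) :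
    VertexSet (Lk {x} C) ⊆ VertexSet C :=
  fun _ hv => hC _ hv.2 _ Finset.subset_union_left

theorem IsFacet.insert_of_link [DecidableEq V] {C : Set (Finset V)} {x : V} {G : Finset V}
    (hG : IsFacet (Lk {x} C) G) : x ∉ G ∧ IsFacet C (insert x G) := by
  have hx : x ∉ G := by
    have := hG.1.1
    rwa [← Finset.disjoint_iff_inter_eq_empty, Finset.disjoint_singleton_right] at this
  refine ⟨hx, by simpa [Finset.union_comm] using hG.1.2, fun H hH hGH => ?_⟩
  have hxH : x ∈ H := hGH (Finset.mem_insert_self _ _)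
  have := hG.2 (H.erase x) ⟨by simp, by
    rwa [Finset.union_comm, ← Finset.insert_eq, Finset.insert_erase hxH]⟩
    (Finset.subset_erase.2 ⟨(Finset.subset_insert _ _).trans hGH, hx⟩)
  rw [← this, Finset.insert_erase hxH]

theorem IsFacet.erase_link [DecidableEq V] {C : Set (Finset V)} {x : V} {X : Finset V}
    (hX : IsFacet C X) (hx : x ∈ X) : IsFacet (Lk {x} C) (X.erase x) := by
  refine ⟨⟨by simp, by
    rw [Finset.union_comm, ← Finset.insert_eq, Finset.insert_erase hx]; exact hX.1⟩, ?_⟩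
  intro G hG hXG
  have hxG : x ∉ G := by
    have := hG.1
    rwa [← Finset.disjoint_iff_inter_eq_empty, Finset.disjoint_singleton_right] at this
  have h := hX.2 (insert x G) (by simpa [Finset.union_comm] using hG.2)
    (by rw [← Finset.insert_erase hx]; exact Finset.insert_subset_insert _ hXG)
  rw [← h, Finset.erase_insert hxG]

theorem IsFacetPath.insert_of_link [DecidableEq V] {C : Set (Finset V)} {d L : ℕ} {x : V}
    {Γ : ℕ → Finset V} (h : IsFacetPath (Lk {x} C) d Γ L) :
    IsFacetPath C (d + 1) (fun i => insert x (Γ i)) L := by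
  refine ⟨fun i hi => (h.1 i hi).insert_of_link.2, fun i hi => ?_⟩
  have hx := (h.1 i hi.le).insert_of_link.1
  dsimp only
  rw [← Finset.insert_inter_distrib, Finset.card_insert_of_notMem (by simp [hx]), h.2 i hi]

theorem NonRevisiting.insert [DecidableEq V] {L : ℕ} {Γ : ℕ → Finset V} (h : NonRevisiting Γ L)
    (x : V) : NonRevisiting (fun i => insert x (Γ i)) L := by
  intro v i j k hik hkj hj hi hj'
  simp only [Finset.mem_insert] at hi hj' ⊢
  by_cases hv : v = x
  · exact Or.inl hv
  · exact Or.inr (h v i j k hik hkj hj (hi.resolve_left hv) (hj'.resolve_left hv))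

theorem NonRevisiting.const (X : Finset V) (L : ℕ) : NonRevisiting (fun _ => X) L :=
  fun _ _ _ _ _ _ _ h _ => h

/-- Follow `Γ` for `a` steps and then follow `Δ`. -/
def pathAppend (Γ Δ : ℕ → Finset V) (a : ℕ) (i : ℕ) : Finset V :=
  if i ≤ a then Γ i else Δ (i - a)

theorem pathAppend_of_le {Γ Δ : ℕ → Finset V} {a i : ℕ} (h : i ≤ a) :
    pathAppend Γ Δ a i = Γ i := if_pos h

theorem pathAppend_of_ge {Γ Δ : ℕ → Finset V} {a i : ℕ} (h : a ≤ i) (e : Γ a = Δ 0) :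
    pathAppend Γ Δ a i = Δ (i - a) := by
  rcases h.eq_or_lt with rfl | h
  · simp [pathAppend, e]
  · exact if_neg (by omega)

theorem IsFacetPath.append [DecidableEq V] {C : Set (Finset V)} {d a b : ℕ}
    {Γ Δ : ℕ → Finset V} (hΓ : IsFacetPath C d Γ a) (hΔ : IsFacetPath C d Δ b)
    (e : Γ a = Δ 0) : IsFacetPath C d (pathAppend Γ Δ a) (a + b) := by
  constructor
  · intro i hi
    rcases le_total i a with h | h
    · rw [pathAppend_of_le h]; exact hΓ.1 i h
    · rw [pathAppend_of_ge h e]; exact hΔ.1 _ (by omega)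
  · intro i hi
    rcases lt_or_ge i a with h | h
    · rw [pathAppend_of_le h.le, pathAppend_of_le h]; exact hΓ.2 i h
    · rw [pathAppend_of_ge h e, pathAppend_of_ge (by omega) e, Nat.sub_add_comm h]
      exact hΔ.2 _ (by omega)

theorem NonRevisiting.append {a b : ℕ} {Γ Δ : ℕ → Finset V} (hΓ : NonRevisiting Γ a)
    (hΔ : NonRevisiting Δ b) (e : Γ a = Δ 0)
    (h : ∀ i ≤ a, ∀ j ≤ b, ∀ v ∈ Γ i, v ∈ Δ j → v ∈ Γ a) :
    NonRevisiting (pathAppend Γ Δ a) (a + b) := by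
  intro v i j k hik hkj hj hi hj'
  rcases le_total j a with hja | hja
  · rw [pathAppend_of_le (by omega)] at hi hj' ⊢
    exact hΓ v i j k hik hkj hja hi hj'
  rw [pathAppend_of_ge hja e] at hj'
  rcases le_total i a with hia | hia
  · rw [pathAppend_of_le hia] at hi
    have hva := h i hia (j - a) (by omega) v hi hj'
    rcases le_total k a with hka | hka
    · rw [pathAppend_of_le hka]
      exact hΓ v i a k hik hka le_rfl hi hva
    · rw [pathAppend_of_ge hka e]
      exact hΔ v 0 (j - a) (k - a) (by omega) (by omega) (by omega) (e ▸ hva) hj'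
  · rw [pathAppend_of_ge hia e] at hi
    rw [pathAppend_of_ge (by omega) e]
    exact hΔ v (i - a) (j - a) (k - a) (by omega) (by omega) (by omega) hi hj'

/-- The path `Γ` meets the vertex set `S` for the first time at its end, in the vertex `y`, and
every neighbour of `y` on the path lies in the last facet. -/
structure IsSegmentTo [DecidableEq V] (C : Set (Finset V)) (d : ℕ) (S : Set V)
    (Γ : ℕ → Finset V) (L : ℕ) (y : V) : Prop where
  path : IsFacetPath C d Γ L
  nonRevisiting : NonRevisiting Γ L
  mem : y ∈ S
  mem_last : y ∈ Γ L
  notMem : ∀ i < L, ∀ v ∈ Γ i, v ∉ S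
  adj_mem : ∀ i ≤ L, ∀ v ∈ Γ i, {v, y} ∈ C → v ∈ Γ L

theorem IsSegmentTo.const [DecidableEq V] {C : Set (Finset V)} (d : ℕ) {S : Set V}
    {X : Finset V} (hX : IsFacet C X) {y : V} (hyS : y ∈ S) (hyX : y ∈ X) :
    IsSegmentTo C d S (fun _ => X) 0 y :=
  ⟨⟨fun _ _ => hX, by simp⟩, .const X 0, hyS, hyX, by simp, fun _ _ _ h _ => h⟩

/-- Extending a segment to the neighbourhood of `S` by a segment to `S` in a vertex link. -/
theorem IsSegmentTo.append_link [DecidableEq V] {C : Set (Finset V)} (hC : IsComplex C)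
    (hcl : IsCliqueCplx C) {d a b : ℕ} {S : Set V} {Γ Δ : ℕ → Finset V} {x y : V}
    (hΓ : IsSegmentTo C (d + 1) {u | ∃ s ∈ S, {u, s} ∈ C} Γ a x)
    (hΔ : IsSegmentTo (Lk {x} C) d S Δ b y) (e : Γ a = insert x (Δ 0))
    (ha : ∀ v ∈ Γ a, v ∉ S) :
    IsSegmentTo C (d + 1) S (pathAppend Γ (fun i => insert x (Δ i)) a) (a + b) y := by
  have hface : ∀ i ≤ b, insert x (Δ i) ∈ C := fun i hi => ((hΔ.path.1 i hi).insert_of_link.2).1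
  refine ⟨hΓ.path.append hΔ.path.insert_of_link e,
    hΓ.nonRevisiting.append (hΔ.nonRevisiting.insert x) e ?_, hΔ.mem, ?_, ?_, ?_⟩
  · intro i hi j hj v hv hv'
    refine hΓ.adj_mem i hi v hv (hC _ (hface j hj) _ ?_)
    intro u hu
    simp only [Finset.mem_insert, Finset.mem_singleton] at hu
    rcases hu with rfl | rfl
    · exact hv'
    · exact Finset.mem_insert_self _ _
  · rw [pathAppend_of_ge (by omega) e]
    simpa using Or.inr hΔ.mem_last
  · intro i hi v hv hvS
    rcases lt_trichotomy i a with h | rfl | h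
    · rw [pathAppend_of_le h.le] at hv
      refine hΓ.notMem i h v hv ⟨v, hvS, ?_⟩
      exact hC _ (hΓ.path.1 i h.le).1 _ (by simpa using hv)
    · rw [pathAppend_of_le le_rfl] at hv
      exact ha v hv hvS
    · rw [pathAppend_of_ge h.le e] at hv
      rcases Finset.mem_insert.1 hv with rfl | hv
      · exact ha v hΓ.mem_last hvS
      · exact hΔ.notMem _ (by omega) v hv hvS
  · intro i hi v hv hvy
    rw [pathAppend_of_ge (i := a + b) (by omega) e, Nat.add_sub_cancel_left]
    rcases lt_or_ge i a with h | h
    · rw [pathAppend_of_le h.le] at hv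
      exact absurd ⟨y, hΔ.mem, hvy⟩ (hΓ.notMem i h v hv)
    rw [pathAppend_of_ge h e] at hv
    rcases Finset.mem_insert.1 hv with rfl | hv
    · exact Finset.mem_insert_self _ _
    have hib : i - a ≤ b := by omega
    have hvx : v ≠ x := fun h => (hΔ.path.1 _ hib).insert_of_link.1 (h ▸ hv)
    have hyx : y ≠ x := fun h => (hΔ.path.1 _ le_rfl).insert_of_link.1 (h ▸ hΔ.mem_last)
    have hsub : ∀ i ≤ b, ∀ u ∈ Δ i, ∀ s ⊆ ({u, x} : Finset V), s ∈ C := by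
      intro i hi u hu s hs
      refine hC _ (hface i hi) _ (hs.trans ?_)
      intro w hw
      simp only [Finset.mem_insert, Finset.mem_singleton] at hw ⊢
      rcases hw with rfl | rfl
      · exact Or.inr hu
      · exact Or.inl rfl
    refine Finset.mem_insert_of_mem (hΔ.adj_mem _ hib v hv ⟨?_, hcl _ ?_⟩)
    · rw [← Finset.disjoint_iff_inter_eq_empty, Finset.disjoint_singleton_right]
      simp [hvx.symm, hyx.symm]
    · have hv2 := hsub _ hib v hv
      have hy2 := hsub _ le_rfl y hΔ.mem_last
      intro p hp q hq
      simp only [Finset.mem_union, Finset.mem_insert, Finset.mem_singleton] at hp hq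
      rcases hp with (rfl | rfl) | rfl <;> rcases hq with (rfl | rfl) | rfl <;>
        first
        | exact hvy
        | (rw [Finset.pair_comm]; exact hvy)
        | (apply hv2; intro w; simp only [Finset.mem_insert, Finset.mem_singleton]; tauto)
        | (apply hy2; intro w; simp only [Finset.mem_insert, Finset.mem_singleton]; tauto)

theorem TriMfld.exists_isSegmentTo [DecidableEq V] {d : ℕ} {C : Set (Finset V)}
    (hM : TriMfld d C) (hcl : IsCliqueCplx C) (hconn : DualConnected C d)
    (hfin : (VertexSet C).Finite) {X : Finset V} (hX : IsFacet C X) {S : Set V} {s : V}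
    (hs : s ∈ S) (hsC : {s} ∈ C) : ∃ Γ L y, Γ 0 = X ∧ IsSegmentTo C d S Γ L y := by
  induction d generalizing C X S s with
  | zero =>
    by_cases hXS : ∃ x ∈ X, x ∈ S
    · obtain ⟨x, hxX, hxS⟩ := hXS
      exact ⟨_, _, _, rfl, .const 0 hX hxS hxX⟩
    push Not at hXS
    obtain ⟨F, hF, hsF⟩ := hM.isComplex.exists_isFacet hfin hsC
    obtain ⟨x, rfl⟩ := Finset.card_eq_one.1 (hM.pure X hX)
    obtain ⟨y, rfl⟩ := Finset.card_eq_one.1 (hM.pure F hF)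
    obtain rfl : s = y := by simpa using hsF
    have hxs : x ≠ s := fun h => hXS x (by simp) (h ▸ hs)
    refine ⟨fun i => if i = 0 then {x} else {s}, 1, s, rfl, ⟨fun i _ => ?_, fun i hi => ?_⟩,
      ?_, hs, by simp, ?_, ?_⟩
    · dsimp only; split_ifs <;> assumption
    · obtain rfl : i = 0 := by omega
      simp [hxs]
    · intro v i j k hik hkj hj hi hj'
      obtain rfl | rfl : k = i ∨ k = j := by omega
      exacts [hi, hj']
    · intro i hi v hv
      obtain rfl : i = 0 := by omega
      exact hXS v hv
    · intro i hi v hv hvs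
      have := hF.2 _ hvs (by simp)
      have hv' : v ∈ ({v, s} : Finset V) := by simp
      rw [this] at hv'
      simpa using hv'
  | succ d ih =>
    obtain ⟨F, hF, hsF⟩ := hM.isComplex.exists_isFacet hfin hsC
    obtain ⟨P, L, hP, hP0, hPL⟩ := hconn X F hX hF
    have hsP : s ∈ P L := hPL ▸ hsF (by simp)
    clear hPL hsF hF hsC F
    have hpair : ∀ {F : Finset V} {u v : V}, F ∈ C → u ∈ F → v ∈ F → {u, v} ∈ C := by
      intro F u v hF hu hv
      refine hM.isComplex F hF _ fun w hw => ?_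
      simp only [Finset.mem_insert, Finset.mem_singleton] at hw
      rcases hw with rfl | rfl <;> assumption
    induction L generalizing S s with
    | zero => exact ⟨_, _, _, rfl, .const _ hX hs (hP0 ▸ hsP)⟩
    | succ k ihk =>
      by_cases hXS : ∃ x ∈ X, x ∈ S
      · obtain ⟨x, hxX, hxS⟩ := hXS
        exact ⟨_, _, _, rfl, .const _ hX hxS hxX⟩
      push Not at hXS
      have hmeet : ∀ {Γ : ℕ → Finset V} {m i : ℕ}, IsFacetPath C (d + 1) Γ m → i < m →
          ∃ u, u ∈ Γ i ∧ u ∈ Γ (i + 1) := by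
        intro Γ m i h hi
        have : (Γ i ∩ Γ (i + 1)).Nonempty := by
          rw [← Finset.card_pos, h.2 i hi]; omega
        obtain ⟨u, hu⟩ := this
        exact ⟨u, Finset.mem_inter.1 hu⟩
      obtain ⟨u, huk, huk'⟩ := hmeet hP k.lt_succ_self
      obtain ⟨Γ, a, x, hΓ0, hΓ⟩ := ihk (S := {u | ∃ s ∈ S, {u, s} ∈ C}) (s := u)
        ⟨s, hs, hpair (hP.1 _ le_rfl).1 huk' hsP⟩
        ⟨fun i hi => hP.1 i (by omega), fun i hi => hP.2 i (by omega)⟩ huk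
      have ha : ∀ v ∈ Γ a, v ∉ S := by
        intro v hv hvS
        cases a with
        | zero => exact hXS v (hΓ0 ▸ hv) hvS
        | succ a =>
          obtain ⟨w, hwa, hwa'⟩ := hmeet hΓ.path a.lt_succ_self
          exact hΓ.notMem a a.lt_succ_self w hwa
            ⟨v, hvS, hpair (hΓ.path.1 _ le_rfl).1 hwa' hv⟩
      have hxC : {x} ∈ C := by
        simpa using hpair (hΓ.path.1 _ le_rfl).1 hΓ.mem_last hΓ.mem_last
      obtain ⟨t, htS, hxt⟩ := hΓ.mem
      have htx : t ≠ x := fun h => ha x hΓ.mem_last (h ▸ htS)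
      obtain ⟨Δ, b, y, hΔ0, hΔ⟩ := ih (hM.2.2.2 x hxC).1 (hcl.link hM.isComplex hxC)
        (hM.dualConnected_link hxC) (hfin.subset (vertexSet_link_subset hM.isComplex x))
        ((hΓ.path.1 _ le_rfl).erase_link hΓ.mem_last) htS
        ⟨by simp [htx], by rw [Finset.union_comm]; exact hxt⟩
      refine ⟨_, _, y, ?_, hΓ.append_link hM.isComplex hcl hΔ ?_ ha⟩
      · rw [pathAppend_of_le (Nat.zero_le _), hΓ0]
      · rw [hΔ0, Finset.insert_erase hΓ.mem_last]

theorem TriMfld.exists_nonRevisiting [DecidableEq V] {d : ℕ} {C : Set (Finset V)}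
    (hM : TriMfld d C) (hcl : IsCliqueCplx C) (hconn : DualConnected C d)
    (hfin : (VertexSet C).Finite) {X Y : Finset V} (hX : IsFacet C X) (hY : IsFacet C Y) :
    ∃ Γ L, IsFacetPath C d Γ L ∧ NonRevisiting Γ L ∧ Γ 0 = X ∧ Γ L = Y := by
  induction d generalizing C X Y with
  | zero =>
    obtain ⟨y, rfl⟩ := Finset.card_eq_one.1 (hM.pure Y hY)
    obtain ⟨Γ, L, z, hΓ0, hΓ⟩ := hM.exists_isSegmentTo hcl hconn hfin hX
      (Set.mem_singleton y) hY.1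
    obtain rfl : z = y := hΓ.mem
    refine ⟨Γ, L, hΓ.path, hΓ.nonRevisiting, hΓ0, ?_⟩
    exact hY.2 _ (hΓ.path.1 _ le_rfl).1 (by simpa using hΓ.mem_last)
  | succ d ih =>
    obtain ⟨s, hs⟩ : Y.Nonempty := by
      rw [← Finset.card_pos, hM.pure Y hY]; omega
    obtain ⟨Γ, a, y, hΓ0, hΓ⟩ := hM.exists_isSegmentTo hcl hconn hfin hX (S := {v | v ∈ Y}) hs
      (hM.isComplex Y hY.1 _ (by simpa using hs))
    have hyY : y ∈ Y := hΓ.mem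
    have hyC : {y} ∈ C := hM.isComplex Y hY.1 _ (by simpa using hyY)
    obtain ⟨Δ, b, hΔ, hΔn, hΔ0, hΔb⟩ := ih (hM.2.2.2 y hyC).1 (hcl.link hM.isComplex hyC)
        (hM.dualConnected_link hyC) (hfin.subset (vertexSet_link_subset hM.isComplex y))
        ((hΓ.path.1 _ le_rfl).erase_link hΓ.mem_last) (hY.erase_link hyY)
    have e : Γ a = insert y (Δ 0) := by rw [hΔ0, Finset.insert_erase hΓ.mem_last]
    refine ⟨_, _, hΓ.path.append hΔ.insert_of_link e,
      hΓ.nonRevisiting.append (hΔn.insert y) e ?_, ?_, ?_⟩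
    · intro i hi j hj v hv hv'
      refine hΓ.adj_mem i hi v hv (hM.isComplex _ (hΔ.insert_of_link.1 j hj).1 _ ?_)
      intro u hu
      simp only [Finset.mem_insert, Finset.mem_singleton] at hu
      rcases hu with rfl | rfl
      · exact hv'
      · exact Finset.mem_insert_self _ _
    · rw [pathAppend_of_le (Nat.zero_le _), hΓ0]
    · rw [pathAppend_of_ge (by omega) e, Nat.add_sub_cancel_left, hΔb, Finset.insert_erase hyY]

theorem NonRevisiting.le_card_biUnion [DecidableEq V] {C : Set (Finset V)} {d L : ℕ}
    {Γ : ℕ → Finset V} (hC : PureCplx C d) (hΓ : IsFacetPath C d Γ L)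
    (h : NonRevisiting Γ L) {k : ℕ} (hk : k ≤ L) :
    k + (d + 1) ≤ ((Finset.range (k + 1)).biUnion Γ).card := by
  induction k with
  | zero => simp [hC _ (hΓ.1 0 hk)]
  | succ k ih =>
    obtain ⟨v, hv, hvk⟩ : ∃ v ∈ Γ (k + 1), v ∉ Γ k := by
      by_contra! hsub
      have h1 := hΓ.2 k hk
      rw [Finset.inter_eq_right.2 hsub, hC _ (hΓ.1 _ hk)] at h1
      omega
    have hnot : v ∉ (Finset.range (k + 1)).biUnion Γ := by
      simp only [Finset.mem_biUnion, Finset.mem_range, not_exists, not_and]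
      intro i hi hvi
      exact hvk (h v i (k + 1) k (by omega) (by omega) hk hvi hv)
    have hlt : ((Finset.range (k + 1)).biUnion Γ).card <
        ((Finset.range (k + 1 + 1)).biUnion Γ).card := by
      refine Finset.card_lt_card (Finset.ssubset_iff_of_subset ?_ |>.2 ⟨v, ?_, hnot⟩)
      · exact Finset.biUnion_subset_biUnion_of_subset_left _
          (Finset.range_subset_range.2 (by omega))
      · exact Finset.mem_biUnion.2 ⟨k + 1, by simp, hv⟩
    have := ih (by omega)
    omega

/-- Every connected flag triangulated `d`-manifold on `n` vertices has
dual graph diameter at most `n - (d+1)`. -/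
theorem stmt_11 [DecidableEq V] (C : Set (Finset V)) (d n : ℕ)
    (hM : TriMfld d C) (hflag : FlagCplx C) (hconn : DualConnected C d)
    (hfin : (VertexSet C).Finite) (hn : hfin.toFinset.card = n) :
    ∀ X Y : Finset V, IsFacet C X → IsFacet C Y →
      ∃ Γ L, IsFacetPath C d Γ L ∧ Γ 0 = X ∧ Γ L = Y ∧ L ≤ n - (d + 1) := by
  intro X Y hX hY
  obtain ⟨Γ, L, hΓ, hΓn, h0, hL⟩ :=
    hM.exists_nonRevisiting hflag.isCliqueCplx hconn hfin hX hY
  refine ⟨Γ, L, hΓ, h0, hL, ?_⟩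
  have h1 := hΓn.le_card_biUnion hM.pure hΓ le_rfl
  have h2 : ((Finset.range (L + 1)).biUnion Γ).card ≤ hfin.toFinset.card := by
    refine Finset.card_le_card fun v hv => ?_
    obtain ⟨i, hi, hvi⟩ := Finset.mem_biUnion.1 hv
    have hiL : i ≤ L := by simpa [Nat.lt_succ_iff] using hi
    rw [Set.Finite.mem_toFinset]
    exact hM.isComplex _ (hΓ.1 i hiL).1 _ (by simpa using hvi)
  omega
end
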